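/- arXiv:0910.3974 — 4 statements merged into one kernel-verified Lean document; each statement's English description precedes it below -/
import Mathlib

section
/- Let γ0 = (3 7 5)(1 4 6), γ1 = (3 6)(7 1)(4 2) and γ∞ = (1 3 4 2)(5 7 6) be permutations of {1,…,7}. Then the composite that applies first γ0, then γ1, then γ∞ is the identity permutation, and the subgroup of the symmetric group S_7 generated by γ0, γ1, γ∞ is all of S_7. -/
/- Relabel {1,…,7} as `Fin 7` via i ↦ i - 1.  Cycle (a b c) is `List.formPerm [a-1,b-1,c-1]`. -/

/-- γ0 = (3 7 5)(1 4 6) -/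
def γ₀ : Equiv.Perm (Fin 7) := List.formPerm [2, 6, 4] * List.formPerm [0, 3, 5]

/-- γ1 = (3 6)(7 1)(4 2) -/
def γ₁ : Equiv.Perm (Fin 7) := List.formPerm [2, 5] * List.formPerm [6, 0] * List.formPerm [3, 1]

/-- γ∞ = (1 3 4 2)(5 7 6) -/
def γinf : Equiv.Perm (Fin 7) := List.formPerm [0, 2, 3, 1] * List.formPerm [4, 6, 5]

theorem pow_five_word_eq_swap : (γ₀ * γ₁ * γinf ^ 2) ^ 5 = Equiv.swap 0 1 := by
  decide +kernel

theorem word_eq_formPerm :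
    γ₀ * γ₁ * γ₀ * γ₁ * γinf ^ 2 = List.formPerm [0, 5, 1, 4, 3, 2, 6] := by
  decide +kernel

/-- Applying first γ0, then γ1, then γ∞ is the identity, and γ0, γ1, γ∞ generate `S₇`. -/
theorem stmt0 : γinf * γ₁ * γ₀ = 1 ∧ Subgroup.closure {γ₀, γ₁, γinf} = ⊤ := by
  refine ⟨by decide +kernel, ?_⟩
  have h₀ : γ₀ ∈ Subgroup.closure {γ₀, γ₁, γinf} := Subgroup.subset_closure (by simp)
  have h₁ : γ₁ ∈ Subgroup.closure {γ₀, γ₁, γinf} := Subgroup.subset_closure (by simp)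
  have hinf : γinf ∈ Subgroup.closure {γ₀, γ₁, γinf} := Subgroup.subset_closure (by simp)
  rw [eq_top_iff, ← Equiv.Perm.closure_prime_cycle_swap (by norm_num)
    (List.isCycle_formPerm (l := [0, 5, 1, 4, 3, 2, 6]) (by decide) (by simp))
    (by decide +kernel) ⟨(0 : Fin 7), 1, by decide, rfl⟩, Subgroup.closure_le]
  rintro σ (rfl | rfl)
  · rw [← word_eq_formPerm]
    exact mul_mem (mul_mem (mul_mem (mul_mem h₀ h₁) h₀) h₁) (pow_mem hinf 2)
  · rw [← pow_five_word_eq_swap]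
    exact pow_mem (mul_mem (mul_mem h₀ h₁) (pow_mem hinf 2)) 5
end

section
/- Let γ0* = (3 7 5)(1 4 6), γ1* = (3 6)(7 1)(4 2) and γ∞* = (1 3 4 2)(5 7 6) in S_7. Suppose g0, g1 ∈ S_7 satisfy: g0 has cycle type consisting of two 3-cycles (and one fixed point), g1 has cycle type consisting of three 2-cycles (and one fixed point), the composite applying first g0, then g1, then γ∞* is the identity, and g0, g1, γ∞* together generate S_7. Then there exists h ∈ S_7 commuting with γ∞* such that h g0 h⁻¹ = γ0* and h g1 h⁻¹ = γ1*. In other words, the Nielsen class ni(S_7, C*)′ has exactly one element. -/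
set_option synthInstance.maxSize 1000 in
/-- A self-inverse map `φ` of `Fin 7` with values `a, b, c, d, e, f, g`, with a single fixed point
and with `γinf ∘ φ` of order dividing 3, is conjugate to `γ₁` by a power of `γinf`. The equivalences
between values say that `φ` is self-inverse. -/
lemma exists_iterate_conj_values :
    ∀ a b : Fin 7, (a = 1 ↔ b = 0) →
    ∀ c : Fin 7, (a = 2 ↔ c = 0) → (b = 2 ↔ c = 1) →
    ∀ d : Fin 7, (a = 3 ↔ d = 0) → (b = 3 ↔ d = 1) → (c = 3 ↔ d = 2) →
    ∀ e : Fin 7, (a = 4 ↔ e = 0) → (b = 4 ↔ e = 1) → (c = 4 ↔ e = 2) → (d = 4 ↔ e = 3) →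
    ∀ f : Fin 7, (a = 5 ↔ f = 0) → (b = 5 ↔ f = 1) → (c = 5 ↔ f = 2) → (d = 5 ↔ f = 3) →
      (e = 5 ↔ f = 4) →
    ∀ g : Fin 7, (a = 6 ↔ g = 0) → (b = 6 ↔ g = 1) → (c = 6 ↔ g = 2) → (d = 6 ↔ g = 3) →
      (e = 6 ↔ g = 4) → (f = 6 ↔ g = 5) →
    (Finset.univ.filter fun x => ![a, b, c, d, e, f, g] x = x).card = 1 →
    (∀ x : Fin 7, (fun y => ![2, 0, 3, 1, 6, 4, 5] (![a, b, c, d, e, f, g] y))^[3] x = x) →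
    ∃ k : Fin 12, ∀ x : Fin 7, (![2, 0, 3, 1, 6, 4, 5])^[k] (![a, b, c, d, e, f, g] x) =
      ![6, 3, 5, 1, 4, 2, 0] ((![2, 0, 3, 1, 6, 4, 5])^[k] x) := by
  decide +kernel

lemma coe_γinf : ⇑γinf = ![2, 0, 3, 1, 6, 4, 5] := by decide +kernel

lemma coe_γ₁ : ⇑γ₁ = ![6, 3, 5, 1, 4, 2, 0] := by decide +kernel

lemma γinf_mul_γ₁_mul_γ₀ : γinf * γ₁ * γ₀ = 1 := by decide +kernel

lemma exists_pow_mul_eq (g : Equiv.Perm (Fin 7)) (hsq : g ^ 2 = 1)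
    (hfix : (Finset.univ.filter fun x => g x = x).card = 1) (hcube : (γinf * g) ^ 3 = 1) :
    ∃ k : ℕ, γinf ^ k * g = γ₁ * γinf ^ k := by
  have hinv : ∀ i j, g i = j ↔ g j = i := by
    have h : ∀ i, g (g i) = i := fun i => by
      rw [← Equiv.Perm.mul_apply, ← sq, hsq, Equiv.Perm.one_apply]
    exact fun i j => ⟨fun hij => hij ▸ h i, fun hji => hji ▸ h j⟩
  have hg : ⇑g = ![g 0, g 1, g 2, g 3, g 4, g 5, g 6] := by
    ext x; fin_cases x <;> rfl
  obtain ⟨k, hk⟩ := exists_iterate_conj_values (g 0) (g 1) (hinv _ _)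
    (g 2) (hinv _ _) (hinv _ _) (g 3) (hinv _ _) (hinv _ _) (hinv _ _)
    (g 4) (hinv _ _) (hinv _ _) (hinv _ _) (hinv _ _)
    (g 5) (hinv _ _) (hinv _ _) (hinv _ _) (hinv _ _) (hinv _ _)
    (g 6) (hinv _ _) (hinv _ _) (hinv _ _) (hinv _ _) (hinv _ _) (hinv _ _)
    (by rw [← hg]; exact hfix)
    (by
      intro x
      rw [← hg, ← coe_γinf]
      exact DFunLike.congr_fun hcube x)
  refine ⟨k, Equiv.ext fun x => ?_⟩
  have := hk x
  rw [← hg, ← coe_γinf, ← coe_γ₁, Equiv.Perm.iterate_eq_pow] at this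
  exact this

/-- Uniqueness in Prop. 4.1 (H7comp): any triple (g0, g1, γ∞*) with g0 a product of two disjoint
3-cycles, g1 a product of three disjoint 2-cycles, product one (first g0, then g1, then γ∞*),
generating S₇, is conjugate to (γ₀*, γ₁*, γ∞*) by an element commuting with γ∞*. -/
theorem stmt1 (g₀ g₁ : Equiv.Perm (Fin 7))
    (hc₀ : g₀.cycleType = {3, 3})
    (hc₁ : g₁.cycleType = {2, 2, 2})
    (hprod : γinf * g₁ * g₀ = 1)
    (hgen : Subgroup.closure {g₀, g₁, γinf} = (⊤ : Subgroup (Equiv.Perm (Fin 7)))) :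
    ∃ h : Equiv.Perm (Fin 7),
      Commute h γinf ∧ h * g₀ * h⁻¹ = γ₀ ∧ h * g₁ * h⁻¹ = γ₁ := by
  have hcube : g₀ ^ 3 = 1 := by
    rw [← orderOf_dvd_iff_pow_eq_one, ← Equiv.Perm.lcm_cycleType, hc₀]
    decide
  have hsq : g₁ ^ 2 = 1 := by
    rw [← orderOf_dvd_iff_pow_eq_one, ← Equiv.Perm.lcm_cycleType, hc₁]
    decide
  have hfix : (Finset.univ.filter fun x => g₁ x = x).card = 1 := by
    have hsupp : g₁.support.card = 6 := by
      rw [← Equiv.Perm.sum_cycleType, hc₁]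
      decide
    have hcompl : (Finset.univ.filter fun x => g₁ x = x) = g₁.supportᶜ := by
      ext x; simp
    rw [hcompl, Finset.card_compl, hsupp, Fintype.card_fin]
  obtain ⟨k, hk⟩ := exists_pow_mul_eq g₁ hsq hfix
    (by rw [eq_inv_of_mul_eq_one_left hprod, inv_pow, hcube, inv_one])
  have hcomm : Commute (γinf ^ k) γinf := (Commute.refl γinf).pow_left k
  have h₁ : γinf ^ k * g₁ * (γinf ^ k)⁻¹ = γ₁ := by rw [hk, mul_inv_cancel_right]
  refine ⟨γinf ^ k, hcomm, ?_, h₁⟩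
  rw [eq_inv_of_mul_eq_one_right hprod, eq_inv_of_mul_eq_one_right γinf_mul_γ₁_mul_γ₀,
    ← conj_inv, ← conj_mul, h₁, hcomm.eq, mul_inv_cancel_right]
end

section
/- The projective special linear group PSL_2(ℤ/12) is isomorphic to the direct product PSL_2(ℤ/3) × PSL_2(ℤ/4), and there is no surjective group homomorphism from PSL_2(ℤ/12) onto the symmetric group S_7. -/
open scoped MatrixGroups

namespace Matrix.SpecialLinearGroup

variable {n R S T : Type*} [Fintype n] [DecidableEq n] [CommRing R] [CommRing S] [CommRing T]

/-- A decomposition `R ≃+* S × T` of rings induces `SL n R ≃* SL n S × SL n T`. -/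
noncomputable def mulEquivProd (e : R ≃+* S × T) :
    SpecialLinearGroup n R ≃* SpecialLinearGroup n S × SpecialLinearGroup n T :=
  MulEquiv.ofBijective
    ((map ((RingHom.fst S T).comp (e : R →+* S × T))).prod
      (map ((RingHom.snd S T).comp (e : R →+* S × T)))) <| by
    constructor
    · intro A B h
      rw [MonoidHom.prod_apply, MonoidHom.prod_apply, Prod.mk.injEq] at h
      ext i j
      apply e.injective
      apply Prod.ext
      · exact congrArg (fun M : SpecialLinearGroup n S => M i j) h.1
      · exact congrArg (fun M : SpecialLinearGroup n T => M i j) h.2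
    · rintro ⟨A, B⟩
      let M : Matrix n n R := Matrix.of fun i j => e.symm (A i j, B i j)
      have hS : M.map ((RingHom.fst S T).comp (e : R →+* S × T)) = A := by
        ext i j; simp [M]
      have hT : M.map ((RingHom.snd S T).comp (e : R →+* S × T)) = B := by
        ext i j; simp [M]
      have hM : M.det = 1 := by
        apply e.injective
        rw [map_one]
        apply Prod.ext
        · have h := RingHom.map_det ((RingHom.fst S T).comp (e : R →+* S × T)) M
          rw [RingHom.mapMatrix_apply, hS, A.det_coe] at h
          exact h
        · have h := RingHom.map_det ((RingHom.snd S T).comp (e : R →+* S × T)) M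
          rw [RingHom.mapMatrix_apply, hT, B.det_coe] at h
          exact h
      exact ⟨⟨M, hM⟩, Prod.ext (Subtype.ext hS) (Subtype.ext hT)⟩

/-- A `2 × 2` matrix of determinant one is a quadruple `(a, b, c, d)` with `a d - b c = 1`. -/
def finTwoEquiv (R : Type*) [CommRing R] :
    SL(2, R) ≃ {x : R × R × R × R // x.1 * x.2.2.2 - x.2.1 * x.2.2.1 = 1} where
  toFun A := ⟨(A 0 0, A 0 1, A 1 0, A 1 1), by rw [← det_fin_two, A.det_coe]⟩
  invFun x := ⟨!![x.1.1, x.1.2.1; x.1.2.2.1, x.1.2.2.2], by rw [det_fin_two_of, x.2]⟩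
  left_inv A := by ext i j; fin_cases i <;> fin_cases j <;> rfl
  right_inv x := rfl

theorem card_zmod_three : Nat.card SL(2, ZMod 3) = 24 := by
  rw [Nat.card_congr (finTwoEquiv (ZMod 3)), Nat.card_eq_fintype_card]
  decide +kernel

theorem card_zmod_four : Nat.card SL(2, ZMod 4) = 48 := by
  rw [Nat.card_congr (finTwoEquiv (ZMod 4)), Nat.card_eq_fintype_card]
  decide +kernel

end Matrix.SpecialLinearGroup

/-- The quotient by the center of a direct product is the product of the quotients by the
centers. -/
noncomputable def MulEquiv.quotientCenterProd {G H K : Type*} [Group G] [Group H] [Group K]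
    (e : G ≃* H × K) :
    G ⧸ Subgroup.center G ≃* (H ⧸ Subgroup.center H) × (K ⧸ Subgroup.center K) :=
  let φ := ((QuotientGroup.mk' (Subgroup.center H)).prodMap
    (QuotientGroup.mk' (Subgroup.center K))).comp e.toMonoidHom
  have hφ : Function.Surjective φ :=
    ((QuotientGroup.mk'_surjective _).prodMap (QuotientGroup.mk'_surjective _)).comp e.surjective
  have hker : Subgroup.center G = φ.ker := by
    ext g
    have hg : g ∈ Subgroup.center G ↔ e g ∈ Subgroup.center (H × K) := by
      simp only [Subgroup.mem_center_iff]
      constructor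
      · intro h x
        obtain ⟨y, rfl⟩ := e.surjective x
        rw [← map_mul, h, map_mul]
      · intro h x
        apply e.injective
        rw [map_mul, h, map_mul]
    rw [hg, Subgroup.center_prod, Subgroup.mem_prod, MonoidHom.mem_ker]
    simp [φ, Prod.ext_iff]
  (QuotientGroup.quotientMulEquivOfEq hker).trans
    (QuotientGroup.quotientKerEquivOfSurjective φ hφ)

/-- PSL₂(ℤ/12) ≅ PSL₂(ℤ/3) × PSL₂(ℤ/4), and S₇ is not a quotient of PSL₂(ℤ/12). -/
theorem stmt2 :
    Nonempty (PSL(2, ZMod 12) ≃* PSL(2, ZMod 3) × PSL(2, ZMod 4)) ∧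
    ¬ ∃ f : PSL(2, ZMod 12) →* Equiv.Perm (Fin 7), Function.Surjective f := by
  let e : SL(2, ZMod 12) ≃* SL(2, ZMod 3) × SL(2, ZMod 4) :=
    Matrix.SpecialLinearGroup.mulEquivProd
      (ZMod.chineseRemainder (show Nat.Coprime 3 4 by norm_num))
  refine ⟨⟨e.quotientCenterProd⟩, ?_⟩
  rintro ⟨f, hf⟩
  have h := (Subgroup.card_dvd_of_surjective f hf).trans
    (Subgroup.card_quotient_dvd_card (Subgroup.center SL(2, ZMod 12)))
  rw [Nat.card_congr e.toEquiv, Nat.card_prod, Matrix.SpecialLinearGroup.card_zmod_three,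
    Matrix.SpecialLinearGroup.card_zmod_four, Nat.card_perm, Nat.card_fin] at h
  revert h
  decide
end

section
/- If S ⊆ ℤ/13 is a 4-element subset that is a perfect difference set of multiplicity 1 (every nonzero c ∈ ℤ/13 has exactly one representation as a difference a − b with a, b ∈ S), then there exist j ∈ {0,1,2,3} and c ∈ ℤ/13 such that S = 6ʲ·{1,2,4,10} + c. -/
/-- `D` is a perfect difference set of multiplicity `v` in `ZMod n`: every nonzero `c`
has exactly `v` representations as a difference `a - b` with `a, b ∈ D`. -/
def IsPerfectDifferenceSet {n : ℕ} (D : Finset (ZMod n)) (v : ℕ) : Prop :=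
  ∀ c : ZMod n, c ≠ 0 → ((D ×ˢ D).filter fun p => p.1 - p.2 = c).card = v

/-- Representations of a nonzero difference by a set of multiplicity 1 are unique. -/
theorem IsPerfectDifferenceSet.eq_of_sub_eq_sub {n : ℕ} {D : Finset (ZMod n)}
    (hD : IsPerfectDifferenceSet D 1) {a b c d : ZMod n} (ha : a ∈ D) (hb : b ∈ D)
    (hc : c ∈ D) (hd : d ∈ D) (hab : a ≠ b) (h : a - b = c - d) : a = c := by
  have hle := (hD (a - b) (sub_ne_zero.2 hab)).le
  rw [Finset.card_le_one] at hle
  exact congrArg Prod.fst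
    (hle (a, b) (by simp [ha, hb]) (c, d) (by simp [hc, hd, h]))

/-- A four-element perfect difference set contains two consecutive elements. -/
theorem IsPerfectDifferenceSet.exists_eq_insert {n : ℕ} [Fact (1 < n)] {S : Finset (ZMod n)}
    (hS : IsPerfectDifferenceSet S 1) (hcard : S.card = 4) :
    ∃ b x y : ZMod n, S = {b, b + 1, b + x, b + y} := by
  have hpos := hS 1 one_ne_zero
  obtain ⟨⟨a, b⟩, hab⟩ := Finset.card_pos.1 (hpos ▸ Nat.one_pos)
  obtain ⟨⟨ha, hb⟩, h1⟩ : (a ∈ S ∧ b ∈ S) ∧ a - b = 1 := by simpa using hab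
  obtain rfl : a = b + 1 := by rw [← h1]; ring
  have hsub : ({b, b + 1} : Finset (ZMod n)) ⊆ S := by
    simp [Finset.insert_subset_iff, ha, hb]
  have hpair : (S \ {b, b + 1}).card = 2 := by
    rw [Finset.card_sdiff_of_subset hsub, hcard, Finset.card_pair (by simp)]
  obtain ⟨p, q, -, hpq⟩ := Finset.card_eq_two.1 hpair
  refine ⟨b, p - b, q - b, ?_⟩
  rw [← Finset.union_sdiff_of_subset hsub, hpq]
  ext z
  simp
  tauto

/-- A four-element subset of ℤ/13 containing `0` and `1` whose nonzero differences determine their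
minuends is a translate of some 6ʲ·{1,2,4,10}. -/
theorem exists_image_of_differences_injective :
    ∀ x y : ZMod 13, ({0, 1, x, y} : Finset (ZMod 13)).card = 4 →
      (∀ a ∈ ({0, 1, x, y} : Finset (ZMod 13)), ∀ b ∈ ({0, 1, x, y} : Finset (ZMod 13)),
        a ≠ b → ∀ c ∈ ({0, 1, x, y} : Finset (ZMod 13)),
        ∀ d ∈ ({0, 1, x, y} : Finset (ZMod 13)), a - b = c - d → a = c) →
      ∃ j : Fin 4, ∃ c : ZMod 13, ({0, 1, x, y} : Finset (ZMod 13)) =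
        (({1, 2, 4, 10} : Finset (ZMod 13)).image
          (fun x => 6 ^ (j : ℕ) * x)).image (fun x => x + c) := by
  decide +kernel

/-- Every 4-element perfect difference set of multiplicity 1 in ℤ/13 is a translate of one
of the four sets 6ʲ·{1,2,4,10}, j = 0,1,2,3. -/
theorem stmt10 (S : Finset (ZMod 13)) (hcard : S.card = 4)
    (hS : IsPerfectDifferenceSet S 1) :
    ∃ j : Fin 4, ∃ c : ZMod 13,
      S = (({1, 2, 4, 10} : Finset (ZMod 13)).image
            (fun x => 6 ^ (j : ℕ) * x)).image (fun x => x + c) := by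
  have : Fact (1 < 13) := ⟨by norm_num⟩
  obtain ⟨b, x, y, hSb⟩ := hS.exists_eq_insert hcard
  have himage : S = ({0, 1, x, y} : Finset (ZMod 13)).image (b + ·) := by
    simp [hSb, Finset.image_insert]
  have hmem : ∀ z ∈ ({0, 1, x, y} : Finset (ZMod 13)), b + z ∈ S := fun z hz =>
    himage ▸ Finset.mem_image_of_mem _ hz
  obtain ⟨j, c, hjc⟩ := exists_image_of_differences_injective x y
    (by rw [← hcard, himage, Finset.card_image_of_injective _ (add_right_injective b)])
    (fun a ha a' ha' hne d hd d' hd' h => add_left_cancel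
      (hS.eq_of_sub_eq_sub (hmem a ha) (hmem a' ha') (hmem d hd) (hmem d' hd')
        (by simpa using hne) (by simpa using h)))
  refine ⟨j, b + c, ?_⟩
  rw [himage, hjc, Finset.image_image]
  congr 1
  funext z
  simp only [Function.comp_apply]
  ring
end
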